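/- Let t₁,t₂,t₃,t₄ be nonzero real numbers (with all q-shifted factorials and all factors appearing below nonzero). The polynomials p_n satisfy, for all n ∈ ℕ and all x ∈ ℝ (with p_{−1} := 0 and p_0 = 1), the three-term recurrence 2x p_n(x,t) = A_n p_{n+1}(x,t) + B_n p_n(x,t) + C_n p_{n−1}(x,t), where A_n = (1 − q^{n+3}/(t₁t₂t₃t₄)) / [(1 − q^{2n+3}/(t₁t₂t₃t₄))(1 − q^{2n+4}/(t₁t₂t₃t₄))], C_n = −(1 − q^n) ∏_{1≤j<k≤4}(1 + q^{n+1}/(t_j t_k)) / [(1 − q^{2n+2}/(t₁t₂t₃t₄))(1 − q^{2n+3}/(t₁t₂t₃t₄))], and B_n = t₁/q − q/t₁ − (t₁/q) A_n ∏_{j=2}^{4}(1 + q^{n+2}/(t₁ t_j)) − q C_n / [t₁ ∏_{j=2}^{4}(1 + q^{n+1}/(t₁ t_j))]. -/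

import Mathlib

noncomputable section

open scoped BigOperators
open Finset MeasureTheory Filter Topology

/-- The finite q-shifted factorial `(a;q)_n`. -/
def qp (q a : ℝ) (n : ℕ) : ℝ := ∏ j ∈ Finset.range n, (1 - a * q ^ j)

/-- The infinite q-shifted factorial `(a;q)_∞`. -/
def qpi (q a : ℝ) : ℝ := ∏' j : ℕ, (1 - a * q ^ j)

/-- `z(x) = x + √(x²+1)`, so that `2x = z - 1/z`. -/
def zx (x : ℝ) : ℝ := x + Real.sqrt (x ^ 2 + 1)

/-- The Askey–Wilson type polynomial `p_n(x, t)`. -/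
def pAW (q t1 t2 t3 t4 : ℝ) (n : ℕ) (x : ℝ) : ℝ :=
  (t1 / q) ^ n * qp q (-q ^ 2 / (t1 * t2)) n * qp q (-q ^ 2 / (t1 * t3)) n *
    qp q (-q ^ 2 / (t1 * t4)) n *
  ∑ k ∈ Finset.range (n + 1),
    qp q (q ^ (-(n : ℤ))) k * qp q (q ^ (n + 3) / (t1 * t2 * t3 * t4)) k *
      qp q (-q / (t1 * zx x)) k * qp q (q * zx x / t1) k * q ^ k /
    (qp q q k * qp q (-q ^ 2 / (t1 * t2)) k * qp q (-q ^ 2 / (t1 * t3)) k *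
      qp q (-q ^ 2 / (t1 * t4)) k)

/-- The normalized weight function `w(x, t)`. -/
def wAW (q t1 t2 t3 t4 : ℝ) (x : ℝ) : ℝ :=
  2 * zx x * qpi q (t1 * t2 * t3 * t4 / q ^ 3) *
    (qpi q (-t1 * zx x) * qpi q (t1 / zx x) * qpi q (-t2 * zx x) * qpi q (t2 / zx x) *
      qpi q (-t3 * zx x) * qpi q (t3 / zx x) * qpi q (-t4 * zx x) * qpi q (t4 / zx x)) /
  (qpi q q * qpi q (-(zx x) ^ 2) * qpi q (-q / (zx x) ^ 2) * Real.log (1 / q) *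
    (qpi q (-t1 * t2 / q) * qpi q (-t1 * t3 / q) * qpi q (-t1 * t4 / q) *
      qpi q (-t2 * t3 / q) * qpi q (-t2 * t4 / q) * qpi q (-t3 * t4 / q)))

/-- Splitting off the last factor of a q-shifted factorial. -/
theorem qp_succ (q a : ℝ) (n : ℕ) : qp q a (n + 1) = qp q a n * (1 - a * q ^ n) :=
  Finset.prod_range_succ _ _

/-- Splitting off the first factor of a q-shifted factorial. -/
theorem qp_succ' (q a : ℝ) (n : ℕ) : qp q a (n + 1) = (1 - a) * qp q (a * q) n := by
  unfold qp
  rw [Finset.prod_range_succ', mul_comm, pow_zero, mul_one]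
  congr 1
  exact Finset.prod_congr rfl fun j _ => by ring

/-- `(q⁻ⁿ;q)_k` vanishes for `k > n`. -/
theorem qp_inv_pow_eq_zero {q : ℝ} (hq : q ≠ 0) {n k : ℕ} (h : n < k) :
    qp q (q ^ n)⁻¹ k = 0 :=
  Finset.prod_eq_zero (Finset.mem_range.2 h) (by
    rw [inv_mul_cancel₀ (pow_ne_zero n hq), sub_self])

/-- The factorial `(q;q)_k` does not vanish for `0 < q < 1`. -/
theorem qp_self_ne_zero {q : ℝ} (hq0 : 0 < q) (hq1 : q < 1) (k : ℕ) : qp q q k ≠ 0 :=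
  Finset.prod_ne_zero_iff.2 fun j _ => by
    have : q ^ (j + 1) < 1 := pow_lt_one₀ hq0.le hq1 j.succ_ne_zero
    rw [← pow_succ']
    exact ne_of_gt (sub_pos.2 this)

/-- The coefficients of the basic hypergeometric sum, with `Q` in place of `q ^ n`
and `G` in place of `q ^ 3 / (t₁ t₂ t₃ t₄)`. -/
def awCoeff (q β γ δ G Q : ℝ) (k : ℕ) : ℝ :=
  qp q Q⁻¹ k * qp q (Q * G) k * q ^ k / (qp q q k * qp q β k * qp q γ k * qp q δ k)

/-- The part of the hypergeometric summand depending on `x`. -/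
def awBasis (q e z : ℝ) (k : ℕ) : ℝ := qp q (-e / z) k * qp q (e * z) k

theorem awBasis_succ (q e : ℝ) {z : ℝ} (hz : z ≠ 0) (k : ℕ) :
    awBasis q e z (k + 1) =
      (1 - e * q ^ k * (z - 1 / z) - (e * q ^ k) ^ 2) * awBasis q e z k := by
  unfold awBasis
  rw [qp_succ, qp_succ]
  field_simp
  ring

theorem awCoeff_zero (q β γ δ G Q : ℝ) : awCoeff q β γ δ G Q 0 = 1 := by
  simp [awCoeff, qp]

theorem awCoeff_pow_eq_zero {q : ℝ} (hq : q ≠ 0) (β γ δ G : ℝ) {n k : ℕ} (h : n < k) :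
    awCoeff q β γ δ G (q ^ n) k = 0 := by
  simp [awCoeff, qp_inv_pow_eq_zero hq h]

/-- The coefficient of the forward neighbour in the recurrence of the hypergeometric sums. -/
def awUp (q e b c d Q : ℝ) : ℝ :=
  (1 - Q * (e * b * c * d / q)) * ((1 + e * b * Q) * (1 + e * c * Q) * (1 + e * d * Q)) /
    (e * ((1 - Q ^ 2 * (e * b * c * d / q)) * (1 - Q ^ 2 * (e * b * c * d))))

/-- The coefficient of the backward neighbour in the recurrence of the hypergeometric sums. -/
def awDown (q e b c d Q : ℝ) : ℝ :=
  -(e * (1 - Q) * ((1 + b * c * Q / q) * (1 + b * d * Q / q) * (1 + c * d * Q / q))) /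
    ((1 - Q ^ 2 * (e * b * c * d / q / q)) * (1 - Q ^ 2 * (e * b * c * d / q)))

/-- The rational identity behind the recurrence, after cancellation of common factors. -/
theorem aw_rational_identity {q e b c d Q K : ℝ} (hq : q ≠ 0) (he : e ≠ 0) (hQ : Q ≠ 0)
    (hK : K ≠ 0) (h : 1 - Q ^ 2 * (e * b * c * d / q) ≠ 0) :
    (1 / (e * (q * K)) + e) * ((1 - Q⁻¹ * K) * (1 - Q * (e * b * c * d / q) * K)) * q -
        1 / (e * K) * ((1 + e * b * K) * (1 + e * c * K) * (1 + e * d * K)) =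
      -(Q⁻¹ * (1 - Q * (e * b * c * d / q) * K) *
          ((1 + e * b * Q) * (1 + e * c * Q) * (1 + e * d * Q)) /
          (e * (1 - Q ^ 2 * (e * b * c * d / q)))) +
        e * q * (1 - Q⁻¹ * K) *
          ((1 + b * c * Q / q) * (1 + b * d * Q / q) * (1 + c * d * Q / q)) /
          (1 - Q ^ 2 * (e * b * c * d / q)) := by
  have h' : q - e * Q ^ 2 * b * c * d ≠ 0 := by
    contrapose! h
    field_simp
    linear_combination h
  field_simp
  ring

theorem awCoeff_recurrence {q e b c d G Q : ℝ} (hq0 : 0 < q) (hq1 : q < 1) (he : e ≠ 0)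
    (hQ : Q ≠ 0) (hG : G = e * b * c * d / q)
    (hb : ∀ k, qp q (-(e * b)) k ≠ 0) (hc : ∀ k, qp q (-(e * c)) k ≠ 0)
    (hd : ∀ k, qp q (-(e * d)) k ≠ 0) (h0 : 1 - Q ^ 2 * (G / q) ≠ 0)
    (h1 : 1 - Q ^ 2 * G ≠ 0) (h2 : 1 - Q ^ 2 * (G * q) ≠ 0) (j : ℕ) :
    (1 / (e * q ^ (j + 1)) - e * q ^ (j + 1) - 1 / e + e) *
          awCoeff q (-(e * b)) (-(e * c)) (-(e * d)) G Q (j + 1) -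
        1 / (e * q ^ j) * awCoeff q (-(e * b)) (-(e * c)) (-(e * d)) G Q j =
      awUp q e b c d Q * (awCoeff q (-(e * b)) (-(e * c)) (-(e * d)) G (Q * q) (j + 1) -
          awCoeff q (-(e * b)) (-(e * c)) (-(e * d)) G Q (j + 1)) +
        awDown q e b c d Q * (awCoeff q (-(e * b)) (-(e * c)) (-(e * d)) G (Q / q) (j + 1) -
          awCoeff q (-(e * b)) (-(e * c)) (-(e * d)) G Q (j + 1)) := by
  have hq : q ≠ 0 := hq0.ne'
  set K := q ^ j with hKdef
  have hK : K ≠ 0 := pow_ne_zero j hq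
  set β := -(e * b) with hβ
  set γ := -(e * c) with hγ
  set δ := -(e * d) with hδ
  set D := qp q q j * qp q β j * qp q γ j * qp q δ j with hD
  set h := (1 - β * K) * (1 - γ * K) * (1 - δ * K) with hh
  have hD0 : D ≠ 0 :=
    mul_ne_zero (mul_ne_zero (mul_ne_zero (qp_self_ne_zero hq0 hq1 j) (hb j)) (hc j)) (hd j)
  have last : ∀ {a : ℝ}, (∀ k, qp q a k ≠ 0) → 1 - a * K ≠ 0 := fun {a} ha => by
    have := ha (j + 1)
    rw [qp_succ] at this
    exact right_ne_zero_of_mul this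
  have hqK : 1 - q * K ≠ 0 := last (qp_self_ne_zero hq0 hq1)
  have hh0 : h ≠ 0 := mul_ne_zero (mul_ne_zero (last hb) (last hc)) (last hd)
  have hden : qp q q (j + 1) * qp q β (j + 1) * qp q γ (j + 1) * qp q δ (j + 1) =
      D * ((1 - q * K) * h) := by
    simp only [qp_succ, hD, hh]
    ring
  obtain ⟨H, hH⟩ : ∃ H, H = (1 - q * K) * h := ⟨_, rfl⟩
  have hH0 : H ≠ 0 := hH ▸ mul_ne_zero hqK hh0
  have hW : (1 - q * K) / H = 1 / h := by
    rw [hH]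
    field_simp
  rw [← hH] at hden
  have hpow : q ^ (j + 1) = q * K := pow_succ' q j
  obtain ⟨u, hu⟩ : ∃ u, qp q Q⁻¹ j = u := ⟨_, rfl⟩
  obtain ⟨v, hv⟩ : ∃ v, qp q (Q * G) j = v := ⟨_, rfl⟩
  have hh' : (1 + e * b * K) * (1 + e * c * K) * (1 + e * d * K) = h := by
    simp only [hh, hβ, hγ, hδ]
    ring
  have hKD : qp q q j * qp q β j * qp q γ j * qp q δ j = D := rfl
  clear_value h D K β γ δ
  obtain ⟨R, hR⟩ : ∃ R, R = K / D := ⟨_, rfl⟩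
  have c0 : awCoeff q β γ δ G Q j = u * v * R := by
    unfold awCoeff
    rw [hR, mul_div_assoc, hu, hv, hKD, ← hKdef]
  have c1 : awCoeff q β γ δ G Q (j + 1) =
      (1 - Q⁻¹ * K) * (1 - Q * G * K) * q * (u * v * R) / H := by
    unfold awCoeff
    rw [hden, hpow, qp_succ, qp_succ, hu, hv, ← hKdef, hR]
    field_simp
  have cup : (1 - Q * G) * awCoeff q β γ δ G (Q * q) (j + 1) =
      (1 - Q⁻¹ / q) * ((1 - Q * G * K) * (1 - Q * G * (q * K))) * q * (u * v * R) /
        H := by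
    have hv' : (1 - Q * G) * qp q (Q * q * G) (j + 1) =
        v * (1 - Q * G * K) * (1 - Q * G * (q * K)) := by
      rw [show Q * q * G = Q * G * q by ring, ← qp_succ', qp_succ, qp_succ, hpow, hv, ← hKdef]
    have hu' : qp q (Q * q)⁻¹ (j + 1) = (1 - Q⁻¹ / q) * u := by
      rw [qp_succ', mul_inv, inv_mul_cancel_right₀ hq, hu, div_eq_mul_inv]
    unfold awCoeff
    rw [hden, hpow, hu', hR]
    linear_combination (1 - Q⁻¹ / q) * u * (q * K) / (D * H) * hv'
  have cdown : (1 - Q⁻¹) * awCoeff q β γ δ G (Q / q) (j + 1) =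
      (1 - Q * G / q) * ((1 - Q⁻¹ * K) * (1 - Q⁻¹ * (q * K))) * q * (u * v * R) /
        H := by
    have hu' : (1 - Q⁻¹) * qp q (Q / q)⁻¹ (j + 1) =
        u * (1 - Q⁻¹ * K) * (1 - Q⁻¹ * (q * K)) := by
      rw [show (Q / q)⁻¹ = Q⁻¹ * q by rw [inv_div, div_eq_inv_mul], ← qp_succ', qp_succ,
        qp_succ, hpow, hu, ← hKdef]
    have hv' : qp q (Q / q * G) (j + 1) = (1 - Q * G / q) * v := by
      rw [qp_succ', show Q / q * G = Q * G / q by ring, div_mul_cancel₀ _ hq, hv]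
    unfold awCoeff
    rw [hden, hpow, hv', hR]
    linear_combination (1 - Q * G / q) * v * (q * K) / (D * H) * hu'
  have hup : awUp q e b c d Q * (awCoeff q β γ δ G (Q * q) (j + 1) -
      awCoeff q β γ δ G Q (j + 1)) =
      -(Q⁻¹ * (1 - Q * G * K) * ((1 + e * b * Q) * (1 + e * c * Q) * (1 + e * d * Q)) /
          (e * (1 - Q ^ 2 * G))) * (u * v * R / h) := by
    have key : (1 - Q * G) * (awCoeff q β γ δ G (Q * q) (j + 1) -
        awCoeff q β γ δ G Q (j + 1)) =
        -(Q⁻¹ * (1 - Q * G * K) * (1 - Q ^ 2 * (G * q))) * (u * v * R / h) := by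
      have hfac : (1 - Q⁻¹ / q) * ((1 - Q * G * K) * (1 - Q * G * (q * K))) -
          (1 - Q * G) * ((1 - Q⁻¹ * K) * (1 - Q * G * K)) =
          -(Q⁻¹ / q * (1 - Q * G * K) * (1 - Q ^ 2 * (G * q)) * (1 - q * K)) := by
        field_simp
        ring
      have hqq : q⁻¹ * q = 1 := inv_mul_cancel₀ hq
      linear_combination cup - (1 - Q * G) * c1 + q * (u * v * R) / H * hfac -
        Q⁻¹ * (1 - Q * G * K) * (1 - Q ^ 2 * (G * q)) * (u * v * R) * hW -
        Q⁻¹ * (1 - Q * G * K) * (1 - Q ^ 2 * (G * q)) * (u * v * R) * ((1 - q * K) / H) * hqq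
    have : awUp q e b c d Q = (1 + e * b * Q) * (1 + e * c * Q) * (1 + e * d * Q) /
        (e * ((1 - Q ^ 2 * G) * (1 - Q ^ 2 * (G * q)))) * (1 - Q * G) := by
      rw [awUp, hG, div_mul_cancel₀ _ hq]
      ring
    generalize (1 + e * b * Q) * (1 + e * c * Q) * (1 + e * d * Q) = P at this ⊢
    generalize 1 - Q ^ 2 * (G * q) = s at this key h2
    generalize 1 - Q ^ 2 * G = s' at this h1 ⊢
    generalize 1 - Q * G * K = y at key ⊢
    rw [this, mul_assoc, key]
    field_simp
  have hdown : awDown q e b c d Q * (awCoeff q β γ δ G (Q / q) (j + 1) -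
      awCoeff q β γ δ G Q (j + 1)) =
      e * q * (1 - Q⁻¹ * K) * ((1 + b * c * Q / q) * (1 + b * d * Q / q) * (1 + c * d * Q / q)) /
          (1 - Q ^ 2 * G) * (u * v * R / h) := by
    have key : (1 - Q⁻¹) * (awCoeff q β γ δ G (Q / q) (j + 1) -
        awCoeff q β γ δ G Q (j + 1)) =
        Q⁻¹ * (1 - Q⁻¹ * K) * (1 - Q ^ 2 * (G / q)) * q * (u * v * R / h) := by
      have hfac : (1 - Q * G / q) * ((1 - Q⁻¹ * K) * (1 - Q⁻¹ * (q * K))) -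
          (1 - Q⁻¹) * ((1 - Q⁻¹ * K) * (1 - Q * G * K)) =
          Q⁻¹ * (1 - Q⁻¹ * K) * (1 - Q ^ 2 * (G / q)) * (1 - q * K) := by
        field_simp
        ring
      linear_combination cdown - (1 - Q⁻¹) * c1 + q * (u * v * R) / H * hfac +
        Q⁻¹ * (1 - Q⁻¹ * K) * (1 - Q ^ 2 * (G / q)) * q * (u * v * R) * hW
    have : awDown q e b c d Q =
        e * Q * ((1 + b * c * Q / q) * (1 + b * d * Q / q) * (1 + c * d * Q / q)) /
        ((1 - Q ^ 2 * (G / q)) * (1 - Q ^ 2 * G)) * (1 - Q⁻¹) := by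
      rw [awDown, hG]
      field_simp
      ring
    generalize (1 + b * c * Q / q) * (1 + b * d * Q / q) * (1 + c * d * Q / q) = P at this ⊢
    generalize 1 - Q ^ 2 * (G / q) = s at this key h0
    generalize 1 - Q ^ 2 * G = s' at this h1 ⊢
    generalize 1 - Q⁻¹ * K = y at key ⊢
    rw [this, mul_assoc, key]
    field_simp
  rw [hup, hdown, ← add_mul, hG,
    ← aw_rational_identity hq he hQ hK (by rwa [← hG]), ← hG, c0, c1, hpow]
  rw [hh', hH]
  generalize 1 - Q * G * K = y
  generalize 1 - Q⁻¹ * K = y'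
  field_simp
  ring

/-- The recurrence in `n` of the basic hypergeometric sums. -/
theorem awSum_recurrence {q e b c d G z : ℝ} (hq0 : 0 < q) (hq1 : q < 1) (he : e ≠ 0)
    (hz : z ≠ 0) (hG : G = e * b * c * d / q)
    (hb : ∀ k, qp q (-(e * b)) k ≠ 0) (hc : ∀ k, qp q (-(e * c)) k ≠ 0)
    (hd : ∀ k, qp q (-(e * d)) k ≠ 0) (n : ℕ) (h0 : 1 - (q ^ n) ^ 2 * (G / q) ≠ 0)
    (h1 : 1 - (q ^ n) ^ 2 * G ≠ 0) (h2 : 1 - (q ^ n) ^ 2 * (G * q) ≠ 0) :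
    (z - 1 / z - 1 / e + e) * ∑ k ∈ range (n + 1),
        awCoeff q (-(e * b)) (-(e * c)) (-(e * d)) G (q ^ n) k * awBasis q e z k =
      awUp q e b c d (q ^ n) *
          (∑ k ∈ range (n + 2),
              awCoeff q (-(e * b)) (-(e * c)) (-(e * d)) G (q ^ (n + 1)) k * awBasis q e z k -
            ∑ k ∈ range (n + 1),
              awCoeff q (-(e * b)) (-(e * c)) (-(e * d)) G (q ^ n) k * awBasis q e z k) +
        awDown q e b c d (q ^ n) *
          (∑ k ∈ range (n + 2),
              awCoeff q (-(e * b)) (-(e * c)) (-(e * d)) G (q ^ n / q) k * awBasis q e z k -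
            ∑ k ∈ range (n + 1),
              awCoeff q (-(e * b)) (-(e * c)) (-(e * d)) G (q ^ n) k * awBasis q e z k) := by
  have hq : q ≠ 0 := hq0.ne'
  have hext : ∑ k ∈ range (n + 1),
        awCoeff q (-(e * b)) (-(e * c)) (-(e * d)) G (q ^ n) k * awBasis q e z k =
      1 * awBasis q e z 0 + ∑ k ∈ range (n + 1),
        awCoeff q (-(e * b)) (-(e * c)) (-(e * d)) G (q ^ n) (k + 1) * awBasis q e z (k + 1) := by
    rw [add_comm (1 * _), ← awCoeff_zero q (-(e * b)) (-(e * c)) (-(e * d)) G (q ^ n),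
      ← sum_range_succ' (fun k =>
        awCoeff q (-(e * b)) (-(e * c)) (-(e * d)) G (q ^ n) k * awBasis q e z k),
      sum_range_succ _ (n + 1), awCoeff_pow_eq_zero hq _ _ _ _ n.lt_succ_self]
    ring
  have hmul : (z - 1 / z - 1 / e + e) * ∑ k ∈ range (n + 1),
        awCoeff q (-(e * b)) (-(e * c)) (-(e * d)) G (q ^ n) k * awBasis q e z k =
      ∑ j ∈ range (n + 1),
        ((1 / (e * q ^ (j + 1)) - e * q ^ (j + 1) - 1 / e + e) *
            awCoeff q (-(e * b)) (-(e * c)) (-(e * d)) G (q ^ n) (j + 1) -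
          1 / (e * q ^ j) * awCoeff q (-(e * b)) (-(e * c)) (-(e * d)) G (q ^ n) j) *
        awBasis q e z (j + 1) := by
    have hterm : ∀ k, (z - 1 / z - 1 / e + e) *
        (awCoeff q (-(e * b)) (-(e * c)) (-(e * d)) G (q ^ n) k * awBasis q e z k) =
        (1 / (e * q ^ k) - e * q ^ k - 1 / e + e) *
            awCoeff q (-(e * b)) (-(e * c)) (-(e * d)) G (q ^ n) k * awBasis q e z k -
          1 / (e * q ^ k) * awCoeff q (-(e * b)) (-(e * c)) (-(e * d)) G (q ^ n) k *
            awBasis q e z (k + 1) := fun k => by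
      have hk : q ^ k ≠ 0 := pow_ne_zero k hq
      rw [awBasis_succ q e hz]
      field_simp
      ring
    have hshift : ∑ k ∈ range (n + 1), (1 / (e * q ^ k) - e * q ^ k - 1 / e + e) *
          awCoeff q (-(e * b)) (-(e * c)) (-(e * d)) G (q ^ n) k * awBasis q e z k =
        ∑ k ∈ range (n + 1), (1 / (e * q ^ (k + 1)) - e * q ^ (k + 1) - 1 / e + e) *
          awCoeff q (-(e * b)) (-(e * c)) (-(e * d)) G (q ^ n) (k + 1) *
            awBasis q e z (k + 1) := by
      have h := sum_range_succ (fun k => (1 / (e * q ^ k) - e * q ^ k - 1 / e + e) *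
        awCoeff q (-(e * b)) (-(e * c)) (-(e * d)) G (q ^ n) k * awBasis q e z k) (n + 1)
      rw [sum_range_succ', awCoeff_pow_eq_zero hq _ _ _ _ n.lt_succ_self] at h
      simpa using h.symm
    rw [mul_sum, sum_congr rfl fun k _ => hterm k, sum_sub_distrib, hshift, ← sum_sub_distrib]
    exact sum_congr rfl fun k _ => by ring
  rw [hmul, hext, sum_range_succ' _ (n + 1), sum_range_succ' _ (n + 1), awCoeff_zero,
    awCoeff_zero, add_comm (1 * awBasis q e z 0), add_sub_add_right_eq_sub,
    add_sub_add_right_eq_sub, ← sum_sub_distrib, ← sum_sub_distrib, mul_sum, mul_sum,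
    ← sum_add_distrib]
  refine sum_congr rfl fun j _ => ?_
  rw [awCoeff_recurrence hq0 hq1 he (pow_ne_zero n hq) hG hb hc hd h0 h1 h2 j, ← pow_succ]
  ring

/-- The normalizing prefactor of the polynomials. -/
def awNorm (q e β γ δ : ℝ) (n : ℕ) : ℝ := (1 / e) ^ n * qp q β n * qp q γ n * qp q δ n

theorem awNorm_succ (q e β γ δ : ℝ) (n : ℕ) :
    awNorm q e β γ δ (n + 1) = 1 / e *
      ((1 - β * q ^ n) * (1 - γ * q ^ n) * (1 - δ * q ^ n)) * awNorm q e β γ δ n := by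
  simp only [awNorm, qp_succ, pow_succ]
  ring

theorem pAW_eq (q t1 t2 t3 t4 : ℝ) (hq : q ≠ 0) (n : ℕ) (x : ℝ) :
    pAW q t1 t2 t3 t4 n x =
      awNorm q (q / t1) (-(q / t1 * (q / t2))) (-(q / t1 * (q / t3))) (-(q / t1 * (q / t4))) n *
        ∑ k ∈ range (n + 1),
          awCoeff q (-(q / t1 * (q / t2))) (-(q / t1 * (q / t3))) (-(q / t1 * (q / t4)))
            (q / t1 * (q / t2) * (q / t3) * (q / t4) / q) (q ^ n) k *
          awBasis q (q / t1) (zx x) k := by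
  have h : ∀ s, -q ^ 2 / (t1 * s) = -(q / t1 * (q / s)) := fun s => by ring
  have hG : q ^ (n + 3) / (t1 * t2 * t3 * t4) =
      q ^ n * (q / t1 * (q / t2) * (q / t3) * (q / t4) / q) := by
    rw [pow_add]
    field_simp
  have hz : -q / (t1 * zx x) = -(q / t1) / zx x := by rw [← neg_div, div_div]
  have hz' : q * zx x / t1 = q / t1 * zx x := by ring
  unfold pAW awNorm awCoeff awBasis
  rw [one_div_div, zpow_neg, zpow_natCast, hG, hz, hz', h, h, h]
  congr 1
  exact sum_congr rfl fun k _ => by ring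

theorem zx_pos (x : ℝ) : 0 < zx x := by
  have : |x| < Real.sqrt (x ^ 2 + 1) := by
    rw [← Real.sqrt_sq_eq_abs]
    exact Real.sqrt_lt_sqrt (sq_nonneg x) (lt_add_one _)
  have := neg_abs_le x
  unfold zx
  linarith

theorem zx_sub_inv (x : ℝ) : zx x - 1 / zx x = 2 * x := by
  have h := (zx_pos x).ne'
  have hs : Real.sqrt (x ^ 2 + 1) ^ 2 = x ^ 2 + 1 := Real.sq_sqrt (by positivity)
  field_simp
  unfold zx
  linear_combination hs

/-- Simplification of the coefficient of `p_{n-1}` in the coefficient of `p_n`. -/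
theorem backward_coeff (e r u v w : ℝ) {x y z s : ℝ} (hx : x ≠ 0) (hy : y ≠ 0) (hz : z ≠ 0) :
    e * -(r * (x * y * z * u * v * w) / s) / (x * y * z) = -(e * r * (u * v * w)) / s := by
  rw [div_eq_iff (mul_ne_zero (mul_ne_zero hx hy) hz)]
  ring

theorem three_term_recurrence_p
    (q : ℝ) (hq0 : 0 < q) (hq1 : q < 1) (t1 t2 t3 t4 : ℝ)
    (ht1 : t1 ≠ 0) (ht2 : t2 ≠ 0) (ht3 : t3 ≠ 0) (ht4 : t4 ≠ 0)
    (hne : ∀ k : ℕ,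
      qp q (-q ^ 2 / (t1 * t2)) k ≠ 0 ∧ qp q (-q ^ 2 / (t1 * t3)) k ≠ 0 ∧
      qp q (-q ^ 2 / (t1 * t4)) k ≠ 0 ∧ qp q (-q ^ 2 / (t2 * t3)) k ≠ 0 ∧
      qp q (-q ^ 2 / (t2 * t4)) k ≠ 0 ∧ qp q (-q ^ 2 / (t3 * t4)) k ≠ 0)
    (hfac : ∀ n : ℕ,
      1 - q ^ (2 * n + 2) / (t1 * t2 * t3 * t4) ≠ 0 ∧
      1 - q ^ (2 * n + 3) / (t1 * t2 * t3 * t4) ≠ 0 ∧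
      1 - q ^ (2 * n + 4) / (t1 * t2 * t3 * t4) ≠ 0 ∧
      1 + q ^ (n + 1) / (t1 * t2) ≠ 0 ∧ 1 + q ^ (n + 1) / (t1 * t3) ≠ 0 ∧
      1 + q ^ (n + 1) / (t1 * t4) ≠ 0 ∧ 1 + q ^ (n + 1) / (t2 * t3) ≠ 0 ∧
      1 + q ^ (n + 1) / (t2 * t4) ≠ 0 ∧ 1 + q ^ (n + 1) / (t3 * t4) ≠ 0 ∧
      1 + q ^ (n + 2) / (t1 * t2) ≠ 0 ∧ 1 + q ^ (n + 2) / (t1 * t3) ≠ 0 ∧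
      1 + q ^ (n + 2) / (t1 * t4) ≠ 0) :
    ∀ n : ℕ, ∀ x : ℝ,
      2 * x * pAW q t1 t2 t3 t4 n x =
        ((1 - q ^ (n + 3) / (t1 * t2 * t3 * t4)) /
            ((1 - q ^ (2 * n + 3) / (t1 * t2 * t3 * t4)) *
              (1 - q ^ (2 * n + 4) / (t1 * t2 * t3 * t4)))) *
          pAW q t1 t2 t3 t4 (n + 1) x +
        (t1 / q - q / t1 -
            t1 / q *
              ((1 - q ^ (n + 3) / (t1 * t2 * t3 * t4)) /
                ((1 - q ^ (2 * n + 3) / (t1 * t2 * t3 * t4)) *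
                  (1 - q ^ (2 * n + 4) / (t1 * t2 * t3 * t4)))) *
              ((1 + q ^ (n + 2) / (t1 * t2)) * (1 + q ^ (n + 2) / (t1 * t3)) *
                (1 + q ^ (n + 2) / (t1 * t4))) -
            q *
              (-((1 - q ^ n) *
                  ((1 + q ^ (n + 1) / (t1 * t2)) * (1 + q ^ (n + 1) / (t1 * t3)) *
                    (1 + q ^ (n + 1) / (t1 * t4)) * (1 + q ^ (n + 1) / (t2 * t3)) *
                    (1 + q ^ (n + 1) / (t2 * t4)) * (1 + q ^ (n + 1) / (t3 * t4))) /
                ((1 - q ^ (2 * n + 2) / (t1 * t2 * t3 * t4)) *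
                  (1 - q ^ (2 * n + 3) / (t1 * t2 * t3 * t4))))) /
              (t1 *
                ((1 + q ^ (n + 1) / (t1 * t2)) * (1 + q ^ (n + 1) / (t1 * t3)) *
                  (1 + q ^ (n + 1) / (t1 * t4))))) *
          pAW q t1 t2 t3 t4 n x +
        (-((1 - q ^ n) *
            ((1 + q ^ (n + 1) / (t1 * t2)) * (1 + q ^ (n + 1) / (t1 * t3)) *
              (1 + q ^ (n + 1) / (t1 * t4)) * (1 + q ^ (n + 1) / (t2 * t3)) *
              (1 + q ^ (n + 1) / (t2 * t4)) * (1 + q ^ (n + 1) / (t3 * t4))) /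
          ((1 - q ^ (2 * n + 2) / (t1 * t2 * t3 * t4)) *
            (1 - q ^ (2 * n + 3) / (t1 * t2 * t3 * t4))))) *
          (if n = 0 then 0 else pAW q t1 t2 t3 t4 (n - 1) x) := by
  intro n x
  have hq : q ≠ 0 := hq0.ne'
  obtain ⟨f0, f1, f2, g12, g13, g14, -⟩ := hfac n
  have hβ : ∀ s, -q ^ 2 / (t1 * s) = -(q / t1 * (q / s)) := fun s => by ring
  have hT : ∀ m, q ^ (m + 3) / (t1 * t2 * t3 * t4) =
      q ^ m * (q / t1 * (q / t2) * (q / t3) * (q / t4) / q) := fun m => by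
    rw [pow_add]
    field_simp
  have e0 : q ^ (2 * n + 2) / (t1 * t2 * t3 * t4) =
      (q ^ n) ^ 2 * (q / t1 * (q / t2) * (q / t3) * (q / t4) / q / q) := by
    rw [pow_add, pow_mul']
    field_simp
  have e1 : q ^ (2 * n + 3) / (t1 * t2 * t3 * t4) =
      (q ^ n) ^ 2 * (q / t1 * (q / t2) * (q / t3) * (q / t4) / q) := by
    rw [hT, pow_mul']
  have e2 : q ^ (2 * n + 4) / (t1 * t2 * t3 * t4) =
      (q ^ n) ^ 2 * (q / t1 * (q / t2) * (q / t3) * (q / t4)) := by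
    rw [pow_add, pow_mul']
    field_simp
  have u1 : ∀ s r, q ^ (n + 1) / (s * r) = q / s * (q / r) * q ^ n / q := fun s r => by
    rw [pow_succ]
    field_simp
  have u2 : ∀ s r, q ^ (n + 2) / (s * r) = q / s * (q / r) * q ^ n := fun s r => by
    rw [pow_add]
    field_simp
  rw [e0] at f0
  rw [e1] at f1
  rw [e2] at f2
  rw [u1] at g12 g13 g14
  have hb : ∀ k, qp q (-(q / t1 * (q / t2))) k ≠ 0 := fun k => hβ t2 ▸ (hne k).1
  have hc : ∀ k, qp q (-(q / t1 * (q / t3))) k ≠ 0 := fun k => hβ t3 ▸ (hne k).2.1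
  have hd : ∀ k, qp q (-(q / t1 * (q / t4))) k ≠ 0 := fun k => hβ t4 ▸ (hne k).2.2.1
  have key := awSum_recurrence hq0 hq1 (div_ne_zero hq ht1) (zx_pos x).ne' rfl hb hc hd n
    f0 f1 (by rwa [div_mul_cancel₀ _ hq])
  have hprev : n ≠ 0 → ∑ k ∈ range (n + 2),
      awCoeff q (-(q / t1 * (q / t2))) (-(q / t1 * (q / t3))) (-(q / t1 * (q / t4)))
        (q / t1 * (q / t2) * (q / t3) * (q / t4) / q) (q ^ n / q) k *
          awBasis q (q / t1) (zx x) k =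
      ∑ k ∈ range (n - 1 + 1),
        awCoeff q (-(q / t1 * (q / t2))) (-(q / t1 * (q / t3))) (-(q / t1 * (q / t4)))
          (q / t1 * (q / t2) * (q / t3) * (q / t4) / q) (q ^ (n - 1)) k *
            awBasis q (q / t1) (zx x) k := fun hn => by
    obtain ⟨m, rfl⟩ := Nat.exists_eq_succ_of_ne_zero hn
    rw [Nat.succ_eq_add_one, Nat.add_sub_cancel, pow_succ, mul_div_cancel_right₀ _ hq,
      sum_range_succ, sum_range_succ, awCoeff_pow_eq_zero hq _ _ _ _ (by omega),
      awCoeff_pow_eq_zero hq _ _ _ _ (by omega)]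
    ring
  have hnorm := awNorm_succ q (q / t1) (-(q / t1 * (q / t2))) (-(q / t1 * (q / t3)))
    (-(q / t1 * (q / t4))) n
  have hnorm' : n ≠ 0 → awNorm q (q / t1) (-(q / t1 * (q / t2))) (-(q / t1 * (q / t3)))
      (-(q / t1 * (q / t4))) n = 1 / (q / t1) * ((1 + q / t1 * (q / t2) * q ^ n / q) *
        (1 + q / t1 * (q / t3) * q ^ n / q) * (1 + q / t1 * (q / t4) * q ^ n / q)) *
      awNorm q (q / t1) (-(q / t1 * (q / t2))) (-(q / t1 * (q / t3)))
        (-(q / t1 * (q / t4))) (n - 1) := fun hn => by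
    obtain ⟨m, rfl⟩ := Nat.exists_eq_succ_of_ne_zero hn
    rw [Nat.succ_eq_add_one, Nat.add_sub_cancel, awNorm_succ, pow_succ]
    field_simp
    ring
  have ht : t1 / q = 1 / (q / t1) := (one_div_div _ _).symm
  have hqt : ∀ y z, q * y / (t1 * z) = q / t1 * y / z := fun y z => by
    rw [mul_div_mul_comm, mul_div_assoc]
  rw [pAW_eq _ _ _ _ _ hq, pAW_eq _ _ _ _ _ hq, pAW_eq _ _ _ _ _ hq, ← zx_sub_inv x,
    hT, e0, e1, e2, ht, hqt]
  simp only [u1, u2]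
  rw [awUp, awDown] at key
  have he : q / t1 ≠ 0 := div_ne_zero hq ht1
  generalize q / t1 = e at *
  generalize q / t2 = b at *
  generalize q / t3 = c at *
  generalize q / t4 = d at *
  have hlast : ∀ w S S' : ℝ, (n ≠ 0 → S = S') →
      -((1 - q ^ n) * ((1 + e * b * q ^ n / q) * (1 + e * c * q ^ n / q) *
        (1 + e * d * q ^ n / q) * (1 + b * c * q ^ n / q) * (1 + b * d * q ^ n / q) *
        (1 + c * d * q ^ n / q)) / w) *
          (if n = 0 then 0 else awNorm q e (-(e * b)) (-(e * c)) (-(e * d)) (n - 1) * S') =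
      -(e * (1 - q ^ n) * ((1 + b * c * q ^ n / q) * (1 + b * d * q ^ n / q) *
        (1 + c * d * q ^ n / q))) / w * awNorm q e (-(e * b)) (-(e * c)) (-(e * d)) n * S := by
    intro w S S' h
    by_cases hn : n = 0
    · simp [hn]
    · rw [if_neg hn, h hn, hnorm' hn, ← backward_coeff _ _ _ _ _ g12 g13 g14]
      generalize -((1 - q ^ n) * _ / w) = X
      generalize 1 + e * b * q ^ n / q = y₁ at g12 ⊢
      generalize 1 + e * c * q ^ n / q = y₂ at g13 ⊢
      generalize 1 + e * d * q ^ n / q = y₃ at g14 ⊢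
      field_simp
  rw [hlast _ _ _ hprev, hnorm]
  rw [backward_coeff _ _ _ _ _ g12 g13 g14]
  generalize -(e * (1 - q ^ n) * ((1 + b * c * q ^ n / q) * (1 + b * d * q ^ n / q) *
    (1 + c * d * q ^ n / q))) / _ = C at *
  generalize (1 - (q ^ n) ^ 2 * (e * b * c * d / q)) * (1 - (q ^ n) ^ 2 * (e * b * c * d)) = w at *
  linear_combination awNorm q e (-(e * b)) (-(e * c)) (-(e * d)) n * key
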